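/- arXiv:1403.5458 — 3 statements merged into one kernel-verified Lean document; each statement's English description precedes it below -/
import Mathlib

section
/- For every prime number p and every integer n ≥ 1, the sum Σ C(n,m), taken over all integers m with 1 ≤ m ≤ n−1 such that (p−1) divides m, is congruent to 0 modulo p, where C(n,m) denotes the binomial coefficient. -/
/-- The power sums of a finite field with `q` elements: for `i ≠ 0`, the sum of all `i`-th powers
is `-1` if `q - 1 ∣ i` and `0` otherwise. -/
theorem FiniteField.sum_pow_of_ne_zero {K : Type*} [Field K] [Fintype K] {i : ℕ} (hi : i ≠ 0) :
    ∑ x : K, x ^ i = if Fintype.card K - 1 ∣ i then -1 else 0 := by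
  classical
  rw [← FiniteField.sum_pow_units K i, ← Fintype.sum_subtype_add_sum_subtype (fun x : K => x ≠ 0),
    ← unitsEquivNeZero.sum_comp]
  have hzero : ∑ x : {x : K // ¬x ≠ 0}, (x : K) ^ i = 0 :=
    Finset.sum_eq_zero fun x _ => by rw [not_not.mp x.2, zero_pow hi]
  rw [hzero, add_zero]
  rfl

/-- In a finite field with `q` elements, the binomial coefficients `n.choose m` with `0 < m < n`
and `q - 1 ∣ m` sum to zero. -/
theorem FiniteField.sum_choose_of_card_sub_one_dvd (K : Type*) [Field K] [Fintype K] {n : ℕ}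
    (hn : 1 ≤ n) :
    ∑ m ∈ (Finset.Ico 1 n).filter (fun m => (Fintype.card K - 1) ∣ m), (n.choose m : K) = 0 := by
  have hbinom (x : K) :
      (x + 1) ^ n = 1 + ∑ m ∈ Finset.Ico 1 n, x ^ m * (n.choose m : K) + x ^ n := by
    rw [add_pow, Finset.sum_range_succ, Finset.range_eq_Ico, Finset.sum_eq_sum_Ico_succ_bot hn]
    simp
  have hshift : ∑ x : K, (x + 1) ^ n = ∑ x : K, x ^ n :=
    Equiv.sum_comp (Equiv.addRight (1 : K)) fun x => x ^ n
  simp only [hbinom, Finset.sum_add_distrib, Finset.sum_const, Finset.card_univ, nsmul_eq_mul,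
    FiniteField.cast_card_eq_zero, zero_mul, zero_add, add_eq_right] at hshift
  rw [Finset.sum_comm] at hshift
  rw [Finset.sum_filter, ← neg_eq_zero, ← Finset.sum_neg_distrib]
  refine Eq.trans ?_ hshift
  refine Finset.sum_congr rfl fun m hm => ?_
  rw [← Finset.sum_mul,
    FiniteField.sum_pow_of_ne_zero (Nat.one_le_iff_ne_zero.mp (Finset.mem_Ico.mp hm).1)]
  split_ifs <;> simp

/-- **Hermite–Bachmann congruence.** For every prime `p` and every integer `n ≥ 1`,
`Σ C(n,m) ≡ 0 (mod p)`, the sum running over `1 ≤ m ≤ n−1` with `(p−1) ∣ m`. -/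
theorem hermite_bachmann_congruence (p : ℕ) (hp : p.Prime) (n : ℕ) (hn : 1 ≤ n) :
    (∑ m ∈ (Finset.Ico 1 n).filter (fun m => (p - 1) ∣ m), n.choose m) ≡ 0 [MOD p] := by
  have : Fact p.Prime := ⟨hp⟩
  rw [← ZMod.natCast_eq_natCast_iff]
  simpa only [ZMod.card, Nat.cast_sum, Nat.cast_zero] using
    FiniteField.sum_choose_of_card_sub_one_dvd (ZMod p) hn
end

section
/- Define polynomials α̃_n(y) ∈ ℚ[y] by the identity of formal power series (in t, with coefficients in ℚ[y]): 2t·(e^{yt} − 1)/sinh(2t) = Σ_{n≥0} α̃_n(y) t^n/n!, where sinh(2t) = (e^{2t} − e^{−2t})/2. Then the sequence (α̃_n) satisfies the Almkvist–Meurman property: for all integers h ≥ 0, k ≥ 1, n ≥ 0, the rational number k^n · α̃_n(h/k) is an integer. -/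
open PowerSeries in
/-- The exponential (Hurwitz) coefficients of a product are the binomial convolution. -/
theorem factorial_mul_coeff_mul (f g : PowerSeries ℚ) (n : ℕ) :
    (n.factorial : ℚ) * coeff n (f * g) = ∑ p ∈ Finset.HasAntidiagonal.antidiagonal n,
      (n.choose p.1 : ℚ) * (p.1.factorial * coeff p.1 f) * (p.2.factorial * coeff p.2 g) := by
  rw [coeff_mul, Finset.mul_sum]
  refine Finset.sum_congr rfl fun p hp => ?_
  rw [Finset.HasAntidiagonal.mem_antidiagonal] at hp
  have h := Nat.add_choose_mul_factorial_mul_factorial p.1 p.2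
  rw [← Nat.choose_symm_add, hp] at h
  have h' : (n.factorial : ℚ) = n.choose p.1 * p.1.factorial * p.2.factorial := by
    exact_mod_cast h.symm
  rw [h']
  ring

/-- A power series is Hurwitz integral if its coefficients, as an exponential generating
function, are integers. -/
def IsHurwitzIntegral (f : PowerSeries ℚ) : Prop :=
  ∀ n, (n.factorial : ℚ) * PowerSeries.coeff n f ∈ (Int.castRingHom ℚ).range

namespace IsHurwitzIntegral

open PowerSeries

variable {f g : PowerSeries ℚ}

theorem mul (hf : IsHurwitzIntegral f) (hg : IsHurwitzIntegral g) :
    IsHurwitzIntegral (f * g) := fun n => by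
  rw [factorial_mul_coeff_mul]
  exact sum_mem fun p _ => mul_mem (mul_mem (natCast_mem _ _) (hf _)) (hg _)

theorem sub (hf : IsHurwitzIntegral f) (hg : IsHurwitzIntegral g) :
    IsHurwitzIntegral (f - g) := fun n => by
  rw [map_sub, mul_sub]
  exact sub_mem (hf n) (hg n)

theorem sum {ι : Type*} (s : Finset ι) {F : ι → PowerSeries ℚ}
    (hF : ∀ i ∈ s, IsHurwitzIntegral (F i)) : IsHurwitzIntegral (∑ i ∈ s, F i) := fun n => by
  rw [map_sum, Finset.mul_sum]
  exact sum_mem fun i hi => hF i hi n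

theorem natCast (m : ℕ) : IsHurwitzIntegral (m : PowerSeries ℚ) := fun n => by
  rw [← map_natCast (C (R := ℚ)), coeff_C]
  split_ifs
  · exact mul_mem (natCast_mem _ _) (natCast_mem _ _)
  · simp

theorem X : IsHurwitzIntegral (X : PowerSeries ℚ) := fun n => by
  rw [coeff_X]
  split_ifs
  · exact mul_mem (natCast_mem _ _) (one_mem _)
  · simp

theorem exp_pow (m : ℕ) : IsHurwitzIntegral (exp ℚ ^ m) := fun n => by
  have h : (n.factorial : ℚ) ≠ 0 := by positivity
  rw [exp_pow_eq_rescale_exp, coeff_rescale, coeff_exp]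
  have : (n.factorial : ℚ) * ((m : ℚ) ^ n * algebraMap ℚ ℚ (1 / n.factorial)) = (m : ℚ) ^ n := by
    simp only [Algebra.algebraMap_self, RingHom.id_apply]
    field_simp
  rw [this]
  exact pow_mem (natCast_mem _ _) _

end IsHurwitzIntegral

/-- If `f * s` and `s` are Hurwitz integral, then the exponential coefficients of `f` only have
denominators dividing powers of the constant term of `s`. -/
theorem pow_mul_coeff_mem_of_mul {f s : PowerSeries ℚ} (hs : IsHurwitzIntegral s)
    (hfs : IsHurwitzIntegral (f * s)) {K : ℕ} (hK : PowerSeries.coeff 0 s = K) (n : ℕ) :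
    (K : ℚ) ^ (n + 1) * (n.factorial * PowerSeries.coeff n f) ∈ (Int.castRingHom ℚ).range := by
  induction n using Nat.strong_induction_on with
  | _ n ih =>
    have h := factorial_mul_coeff_mul f s n
    rw [Finset.Nat.sum_antidiagonal_eq_sum_range_succ
      (fun i j => (n.choose i : ℚ) * (i.factorial * PowerSeries.coeff i f) *
        (j.factorial * PowerSeries.coeff j s)), Finset.sum_range_succ] at h
    simp only [Nat.choose_self, Nat.sub_self, Nat.factorial_zero, hK, Nat.cast_one, one_mul] at h
    have h2 : (K : ℚ) ^ (n + 1) * (n.factorial * PowerSeries.coeff n f) =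
        (K : ℚ) ^ n * (n.factorial * PowerSeries.coeff n (f * s)) -
        ∑ i ∈ Finset.range n, (n.choose i : ℚ) * ((K : ℚ) ^ (n - (i + 1)) *
          ((K : ℚ) ^ (i + 1) * (i.factorial * PowerSeries.coeff i f))) *
          ((n - i).factorial * PowerSeries.coeff (n - i) s) := by
      have h3 : ∀ i ∈ Finset.range n, (n.choose i : ℚ) * ((K : ℚ) ^ (n - (i + 1)) *
          ((K : ℚ) ^ (i + 1) * (i.factorial * PowerSeries.coeff i f))) *
          ((n - i).factorial * PowerSeries.coeff (n - i) s) =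
          (K : ℚ) ^ n * ((n.choose i : ℚ) * (i.factorial * PowerSeries.coeff i f) *
          ((n - i).factorial * PowerSeries.coeff (n - i) s)) := fun i hi => by
        rw [← mul_assoc ((K : ℚ) ^ _), ← pow_add,
          Nat.sub_add_cancel (Finset.mem_range.1 hi)]
        ring
      rw [Finset.sum_congr rfl h3, ← Finset.mul_sum, h]
      ring
    rw [h2]
    refine sub_mem (mul_mem (pow_mem (natCast_mem _ _) _) (hfs n)) (sum_mem fun i hi => ?_)
    exact mul_mem (mul_mem (natCast_mem _ _) (mul_mem (pow_mem (natCast_mem _ _) _)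
      (ih i (Finset.mem_range.1 hi)))) (hs _)

/-- A factor coprime to `K` clears the denominators of `K ^ i * bernoulli i` for `i ≤ n`. -/
theorem exists_coprime_mul_pow_mul_bernoulli_mem (K n : ℕ) : ∃ D : ℕ, D.Coprime K ∧
    ∀ i ≤ n, (D : ℚ) * ((K : ℚ) ^ i * bernoulli i) ∈ (Int.castRingHom ℚ).range := by
  set s := (Finset.range (n + 2)).filter fun p => p.Prime ∧ ¬ p ∣ K with hs
  refine ⟨∏ p ∈ s, p, Nat.Coprime.prod_left fun p hp => ?_, fun i hi => ?_⟩
  · rw [hs, Finset.mem_filter] at hp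
    exact (Nat.Prime.coprime_iff_not_dvd hp.2.1).2 hp.2.2
  set D := ∏ p ∈ s, p
  have key : ∀ p < n + 2, p.Prime → i ≠ 0 →
      (D : ℚ) * (K : ℚ) ^ i * (1 / p) ∈ (Int.castRingHom ℚ).range := by
    intro p hpn hp hi0
    have hd : p ∣ D * K ^ i := by
      by_cases hK : p ∣ K
      · exact (hK.trans (dvd_pow_self K hi0)).mul_left _
      · exact (Finset.dvd_prod_of_mem (fun p : ℕ => p)
          (Finset.mem_filter.2 ⟨Finset.mem_range.2 hpn, hp, hK⟩)).mul_right _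
    obtain ⟨c, hc⟩ := hd
    have hp0 : (p : ℚ) ≠ 0 := by exact_mod_cast hp.ne_zero
    have hc' : (D : ℚ) * (K : ℚ) ^ i = p * c := by exact_mod_cast hc
    rw [hc', show (p : ℚ) * c * (1 / p) = c by field_simp]
    exact natCast_mem _ _
  rcases Nat.even_or_odd i with he | ho
  · obtain ⟨m, rfl⟩ := even_iff_two_dvd.1 he
    rcases Nat.eq_zero_or_pos m with rfl | hm
    · simp
    obtain ⟨z, hz⟩ := Bernoulli.vonStaudt_clausen m
    rw [← mul_assoc, eq_sub_iff_add_eq.2 hz.symm, mul_sub, Finset.mul_sum]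
    refine sub_mem (mul_mem (mul_mem (natCast_mem _ _) (pow_mem (natCast_mem _ _) _))
      (intCast_mem _ _)) (sum_mem fun p hp => ?_)
    simp only [Finset.mem_filter, Finset.mem_range] at hp
    exact key p (by omega) hp.2.1 (by omega)
  · by_cases h1 : i = 1
    · subst h1
      have := neg_mem (key 2 (by omega) Nat.prime_two one_ne_zero)
      convert this using 1
      rw [bernoulli_one]
      push_cast
      ring
    · rw [bernoulli_eq_zero_of_odd ho (by have := ho.pos; omega)]
      simp

open PowerSeries in
theorem exp_sub_one_ne_zero : exp ℚ - 1 ≠ 0 := fun h => by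
  simpa [coeff_exp, coeff_one] using congrArg (coeff 1) h

open PowerSeries in
/-- If `f = K t e^{ct} (e^{ht} - 1) / (e^{Kt} - 1)` then `f` is Hurwitz integral. -/
theorem isHurwitzIntegral_of_mul_exp_pow_sub_one {f : PowerSeries ℚ} {K c h : ℕ} (hK : K ≠ 0)
    (hf : f * (exp ℚ ^ K - 1) = (K : PowerSeries ℚ) * PowerSeries.X * (exp ℚ ^ c * (exp ℚ ^ h - 1))) :
    IsHurwitzIntegral f := by
  intro n
  have hg : IsHurwitzIntegral (exp ℚ ^ c * (exp ℚ ^ h - 1)) :=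
    (IsHurwitzIntegral.exp_pow c).mul ((IsHurwitzIntegral.exp_pow h).sub
      (by simpa using IsHurwitzIntegral.exp_pow 0))
  have hS : ∀ m, IsHurwitzIntegral (∑ i ∈ Finset.range m, exp ℚ ^ i) := fun m =>
    IsHurwitzIntegral.sum _ fun i _ => IsHurwitzIntegral.exp_pow i
  have h1 : f * ∑ i ∈ Finset.range K, exp ℚ ^ i =
      (K : PowerSeries ℚ) * PowerSeries.X * (exp ℚ ^ c * ∑ i ∈ Finset.range h, exp ℚ ^ i) := by
    apply mul_right_cancel₀ exp_sub_one_ne_zero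
    rw [mul_assoc, geom_sum_mul, hf, ← geom_sum_mul]
    ring
  have hpow : (K : ℚ) ^ (n + 1) * (n.factorial * coeff n f) ∈ (Int.castRingHom ℚ).range := by
    refine pow_mul_coeff_mem_of_mul (hS K) ?_ (by simp) n
    rw [h1]
    exact ((IsHurwitzIntegral.natCast K).mul IsHurwitzIntegral.X).mul
      ((IsHurwitzIntegral.exp_pow c).mul (hS h))
  have h2 : f = rescale (K : ℚ) (bernoulliPowerSeries ℚ) * (exp ℚ ^ c * (exp ℚ ^ h - 1)) := by
    have hne : exp ℚ ^ K - 1 ≠ 0 := fun h0 => by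
      rw [exp_pow_eq_rescale_exp] at h0
      have := congrArg (coeff 1) h0
      simp [coeff_exp, coeff_one, coeff_rescale, hK] at this
    apply mul_right_cancel₀ hne
    have hb := congrArg (rescale (K : ℚ)) (bernoulliPowerSeries_mul_exp_sub_one ℚ)
    rw [map_mul, map_sub, map_one, ← exp_pow_eq_rescale_exp, rescale_X, map_natCast] at hb
    rw [hf, ← hb]
    ring
  obtain ⟨D, hD, hDb⟩ := exists_coprime_mul_pow_mul_bernoulli_mem K n
  have hDf : (D : ℚ) * (n.factorial * coeff n f) ∈ (Int.castRingHom ℚ).range := by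
    rw [h2, factorial_mul_coeff_mul, Finset.mul_sum]
    refine sum_mem fun p hp => ?_
    have hp1 : (p.1.factorial : ℚ) ≠ 0 := by positivity
    have hb : (p.1.factorial : ℚ) * coeff p.1 (rescale (K : ℚ) (bernoulliPowerSeries ℚ)) =
        (K : ℚ) ^ p.1 * bernoulli p.1 := by
      rw [coeff_rescale, bernoulliPowerSeries, coeff_mk]
      simp only [Algebra.algebraMap_self, RingHom.id_apply]
      field_simp
    rw [hb, ← mul_assoc, mul_left_comm (D : ℚ)]
    exact mul_mem (mul_mem (natCast_mem _ _)
      (hDb p.1 (Finset.HasAntidiagonal.antidiagonal.fst_le hp))) (hg _)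
  have hcop : IsCoprime (D : ℤ) ((K : ℤ) ^ (n + 1)) :=
    (Nat.isCoprime_iff_coprime.2 hD).pow_right
  obtain ⟨a, b, hab⟩ := hcop
  have hab' : (a : ℚ) * D + b * (K : ℚ) ^ (n + 1) = 1 := by exact_mod_cast hab
  have hx : (n.factorial : ℚ) * coeff n f = a * (D * (n.factorial * coeff n f)) +
      b * ((K : ℚ) ^ (n + 1) * (n.factorial * coeff n f)) := by
    linear_combination -((n.factorial : ℚ) * coeff n f) * hab'
  rw [hx]
  exact add_mem (mul_mem (intCast_mem _ _) hDf) (mul_mem (intCast_mem _ _) hpow)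


/-- **Proposition 1.** The polynomials `α̃_n(y)` defined by
`2t·(e^{yt} − 1)/sinh(2t) = Σ_{n≥0} α̃_n(y) t^n/n!` (with `sinh(2t) = (e^{2t} − e^{−2t})/2`)
are in the Granville class: `k^n · α̃_n(h/k) ∈ ℤ` for all `h ≥ 0`, `k ≥ 1`, `n ≥ 0`.
The quotient is encoded by multiplying both sides by `sinh(2t)`, mapped into `ℚ[y][[t]]`. -/
theorem alphaTilde_granville (α : ℕ → Polynomial ℚ)
    (hα : (PowerSeries.mk fun n => ((n.factorial : ℚ)⁻¹) • α n) *
        (PowerSeries.map (Polynomial.C : ℚ →+* Polynomial ℚ)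
          ((1 / 2 : ℚ) • (PowerSeries.rescale 2 (PowerSeries.exp ℚ) -
            PowerSeries.rescale (-2) (PowerSeries.exp ℚ))))
      = 2 * PowerSeries.X *
          ((PowerSeries.mk fun m => ((m.factorial : ℚ)⁻¹) • (Polynomial.X : Polynomial ℚ) ^ m)
            - 1)) :
    ∀ h k n : ℕ, 1 ≤ k → ∃ z : ℤ, (k : ℚ) ^ n * (α n).eval ((h : ℚ) / (k : ℚ)) = (z : ℚ) := by
  intro h k n hk
  have hk0 : (k : ℚ) ≠ 0 := by exact_mod_cast (by omega : k ≠ 0)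
  set y : ℚ := (h : ℚ) / k with hy
  let φ : PowerSeries (Polynomial ℚ) →+* PowerSeries ℚ :=
    (PowerSeries.rescale (k : ℚ)).comp (PowerSeries.map (Polynomial.evalRingHom y))
  set f := φ (PowerSeries.mk fun n => ((n.factorial : ℚ)⁻¹) • α n) with hfdef
  have hX : φ PowerSeries.X = (k : PowerSeries ℚ) * PowerSeries.X := by
    simp [φ, PowerSeries.rescale_X]
  have hexp : φ (PowerSeries.mk fun m => ((m.factorial : ℚ)⁻¹) • (Polynomial.X : Polynomial ℚ) ^ m)
      = PowerSeries.exp ℚ ^ h := by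
    rw [PowerSeries.exp_pow_eq_rescale_exp]
    ext m
    simp only [φ, RingHom.comp_apply, PowerSeries.coeff_rescale, PowerSeries.coeff_map,
      PowerSeries.coeff_mk, PowerSeries.coeff_exp, Polynomial.coe_evalRingHom,
      Polynomial.eval_smul, Polynomial.eval_pow, Polynomial.eval_X, smul_eq_mul,
      Algebra.algebraMap_self, RingHom.id_apply, hy, div_pow]
    field_simp
  have hmap : ∀ g : PowerSeries ℚ, φ (PowerSeries.map (Polynomial.C : ℚ →+* Polynomial ℚ) g) =
      PowerSeries.rescale (k : ℚ) g := fun g => by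
    ext m
    simp [φ, PowerSeries.coeff_rescale]
  have hsinh : PowerSeries.rescale (k : ℚ)
      ((1 / 2 : ℚ) • (PowerSeries.rescale 2 (PowerSeries.exp ℚ) -
        PowerSeries.rescale (-2) (PowerSeries.exp ℚ))) * (2 * PowerSeries.exp ℚ ^ (2 * k)) =
      PowerSeries.exp ℚ ^ (4 * k) - 1 := by
    have e1 : PowerSeries.rescale (k : ℚ) (PowerSeries.rescale 2 (PowerSeries.exp ℚ)) =
        PowerSeries.exp ℚ ^ (2 * k) := by
      rw [PowerSeries.rescale_rescale, PowerSeries.exp_pow_eq_rescale_exp]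
      push_cast
      rfl
    have e2 : PowerSeries.rescale (k : ℚ) (PowerSeries.rescale (-2) (PowerSeries.exp ℚ)) *
        PowerSeries.exp ℚ ^ (2 * k) = 1 := by
      rw [PowerSeries.rescale_rescale, PowerSeries.exp_pow_eq_rescale_exp,
        PowerSeries.exp_mul_exp_eq_exp_add]
      simp
    have e3 : PowerSeries.C (1 / 2 : ℚ) * 2 = 1 := by
      rw [← map_ofNat (PowerSeries.C (R := ℚ)) 2, ← map_mul]
      simp
    have e0 : ∀ g : PowerSeries ℚ, PowerSeries.rescale (k : ℚ) ((1 / 2 : ℚ) • g) =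
        PowerSeries.C (1 / 2 : ℚ) * PowerSeries.rescale (k : ℚ) g := fun g => by
      ext m
      simp [PowerSeries.coeff_rescale, mul_left_comm]
    rw [e0, map_sub, e1,
      show 4 * k = 2 * k + 2 * k by ring, pow_add]
    linear_combination (PowerSeries.exp ℚ ^ (2 * k) * PowerSeries.exp ℚ ^ (2 * k) - 1) * e3 -
      PowerSeries.C (1 / 2 : ℚ) * 2 * e2
  have hfeq := congrArg φ hα
  rw [map_mul, hmap, map_mul, map_mul, map_sub, hexp, hX, map_one, map_ofNat, ← hfdef] at hfeq
  have hf : f * (PowerSeries.exp ℚ ^ (4 * k) - 1) = ((4 * k : ℕ) : PowerSeries ℚ) *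
      PowerSeries.X * (PowerSeries.exp ℚ ^ (2 * k) * (PowerSeries.exp ℚ ^ h - 1)) := by
    rw [← hsinh, ← mul_assoc, hfeq]
    push_cast
    ring
  obtain ⟨z, hz⟩ := isHurwitzIntegral_of_mul_exp_pow_sub_one (K := 4 * k) (by omega) hf n
  refine ⟨z, ?_⟩
  have hn : (n.factorial : ℚ) ≠ 0 := by positivity
  rw [← eq_intCast (Int.castRingHom ℚ) z, hz]
  simp only [hfdef, φ, RingHom.comp_apply, PowerSeries.coeff_rescale, PowerSeries.coeff_map,
    PowerSeries.coeff_mk, Polynomial.coe_evalRingHom, Polynomial.eval_smul, smul_eq_mul]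
  field_simp
end

section
/- Define polynomials λ̃_n(y) ∈ ℚ[y] by the identity of formal power series (in t, with coefficients in ℚ[y]): t·(e^{yt} − 1)/tanh(t) = Σ_{n≥0} λ̃_n(y) t^n/n!, where tanh(t) = (e^t − e^{−t})/(e^t + e^{−t}). Then the sequence (λ̃_n) satisfies the Almkvist–Meurman property: for all integers h ≥ 0, k ≥ 1, n ≥ 0, the rational number k^n · λ̃_n(h/k) is an integer. -/
/-- The integers, as a subring of `ℚ`. -/
abbrev integersInRat : Subring ℚ := (Int.castRingHom ℚ).range

/-- A multiple of all primes `p ≤ j + 1` clears the denominator of the Bernoulli number `B_j`. -/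
lemma mul_bernoulli_mem_integersInRat {N j : ℕ}
    (hN : ∀ p : ℕ, p.Prime → p ≤ j + 1 → p ∣ N) :
    (N : ℚ) * bernoulli j ∈ integersInRat := by
  rcases Nat.even_or_odd' j with ⟨m, rfl | rfl⟩
  · obtain ⟨z, hz⟩ := Bernoulli.vonStaudt_clausen m
    rw [← sub_eq_iff_eq_add.mpr hz, mul_sub, Finset.mul_sum]
    refine sub_mem (mul_mem (natCast_mem _ N) (intCast_mem _ z)) (sum_mem fun p hp => ?_)
    simp only [Finset.mem_filter, Finset.mem_range] at hp
    obtain ⟨c, rfl⟩ := hN p hp.2.1 (by lia)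
    have hp0 : (p : ℚ) ≠ 0 := by exact_mod_cast hp.2.1.ne_zero
    have : ((p * c : ℕ) : ℚ) * (1 / p) = (c : ℚ) := by
      push_cast
      field_simp
    rw [this]
    exact natCast_mem _ c
  · rcases Nat.eq_zero_or_pos m with rfl | hm
    · obtain ⟨c, rfl⟩ := hN 2 Nat.prime_two (by lia)
      have : ((2 * c : ℕ) : ℚ) * bernoulli (2 * 0 + 1) = -(c : ℚ) := by
        rw [mul_zero, zero_add, bernoulli_one]
        push_cast
        ring
      rw [this]
      exact neg_mem (natCast_mem _ c)
    · rw [bernoulli_eq_zero_of_odd ⟨m, rfl⟩ (by lia), mul_zero]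
      exact zero_mem _

/-- For every `k`, there is a number coprime to `k` divisible by all primes `p ≤ n` not
dividing `k`. -/
lemma exists_coprime_forall_prime_dvd_mul (n k : ℕ) :
    ∃ D : ℕ, D ≠ 0 ∧ D.Coprime k ∧ ∀ p : ℕ, p.Prime → p ≤ n → p ∣ D * k := by
  refine ⟨∏ p ∈ Finset.range (n + 1) with p.Prime ∧ ¬ p ∣ k, p, ?_, ?_, fun p hp hpn => ?_⟩
  · refine Finset.prod_ne_zero_iff.mpr fun p hp => ?_
    exact (Finset.mem_filter.mp hp).2.1.ne_zero
  · refine Nat.Coprime.prod_left fun p hp => ?_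
    obtain ⟨-, hp, hpk⟩ := Finset.mem_filter.mp hp
    exact (Nat.Prime.coprime_iff_not_dvd hp).mpr hpk
  · by_cases hpk : p ∣ k
    · exact hpk.mul_left _
    · refine (Finset.dvd_prod_of_mem (fun q : ℕ => q) ?_).mul_right _
      simp [hp, hpk, Nat.lt_succ_of_le hpn]

lemma pow_mul_bernoulli_eval_div_sub (n k : ℕ) (hk : k ≠ 0) (x : ℚ) :
    (k : ℚ) ^ n * ((Polynomial.bernoulli n).eval (x / k) - bernoulli n) =
      ∑ i ∈ Finset.range n,
        (k : ℚ) ^ (n - (i + 1)) * bernoulli (n - (i + 1)) * n.choose (i + 1) * x ^ (i + 1) := by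
  have hk0 : (k : ℚ) ≠ 0 := by exact_mod_cast hk
  rw [Polynomial.bernoulli_def, Polynomial.eval_finsetSum, Finset.sum_range_succ']
  simp only [Polynomial.eval_monomial, Nat.sub_zero, Nat.choose_zero_right, Nat.cast_one, mul_one,
    pow_zero, add_sub_cancel_right, Finset.mul_sum]
  refine Finset.sum_congr rfl fun i hi => ?_
  have hn : n = n - (i + 1) + (i + 1) := by
    have := Finset.mem_range.mp hi
    lia
  have : (k : ℚ) ^ n = k ^ (n - (i + 1)) * k ^ (i + 1) := by rw [← pow_add, ← hn]
  rw [this, div_pow]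
  field_simp

lemma bernoulli_eval_natCast_sub_mem_integersInRat (n m : ℕ) :
    (Polynomial.bernoulli n).eval (m : ℚ) - bernoulli n ∈ integersInRat := by
  cases n with
  | zero => simp
  | succ p =>
    rw [← Nat.succ_eq_add_one, ← Polynomial.sum_range_pow_eq_bernoulli_sub]
    exact mul_mem (add_mem (natCast_mem _ p) (one_mem _))
      (sum_mem fun i _ => pow_mem (natCast_mem _ i) p)

/-- The **Almkvist–Meurman theorem**: `k ^ n * (B_n(h / k) - B_n)` is an integer. -/
theorem almkvist_meurman (n h k : ℕ) (hk : k ≠ 0) :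
    (k : ℚ) ^ n * ((Polynomial.bernoulli n).eval ((h : ℚ) / k) - bernoulli n) ∈
      integersInRat := by
  have hk0 : (k : ℚ) ≠ 0 := by exact_mod_cast hk
  obtain ⟨D, hD0, hDk, hD⟩ := exists_coprime_forall_prime_dvd_mul (n + 1) k
  obtain ⟨m, -, hm⟩ := Nat.exists_mul_mod_eq_of_coprime h hDk.symm hD0
  obtain ⟨q, hq⟩ : (D : ℤ) ∣ (h : ℤ) - ((k * m : ℕ) : ℤ) := Nat.modEq_iff_dvd.mp hm
  have hq' : (h : ℚ) - (k * m : ℕ) = D * q := by exact_mod_cast hq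
  have hint : (k : ℚ) ^ n *
      ((Polynomial.bernoulli n).eval (((k * m : ℕ) : ℚ) / k) - bernoulli n) ∈ integersInRat := by
    rw [Nat.cast_mul, mul_div_cancel_left₀ _ hk0]
    exact mul_mem (pow_mem (natCast_mem _ k) n)
      (bernoulli_eval_natCast_sub_mem_integersInRat n m)
  rw [pow_mul_bernoulli_eval_div_sub n k hk] at hint ⊢
  rw [← sub_add_cancel (Finset.sum _ _) (Finset.sum _ _)]
  refine add_mem ?_ hint
  rw [← Finset.sum_sub_distrib]
  refine sum_mem fun i hi => ?_
  have hcoeff : (D : ℚ) * (k ^ (n - (i + 1)) * bernoulli (n - (i + 1))) ∈ integersInRat := by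
    rcases hs : n - (i + 1) with _ | s
    · simp
    · have := mul_bernoulli_mem_integersInRat (N := D * k) (j := s + 1)
        fun p hp hps => hD p hp (by lia)
      have hmem := mul_mem (pow_mem (natCast_mem integersInRat k) s) this
      push_cast at hmem
      convert hmem using 1
      ring
  obtain ⟨r, hr⟩ := sub_dvd_pow_sub_pow (h : ℤ) ((k * m : ℕ) : ℤ) (i + 1)
  have hr' : (h : ℚ) ^ (i + 1) - ((k * m : ℕ) : ℚ) ^ (i + 1) = D * q * r := by
    rw [← hq']
    exact_mod_cast hr
  have hmem := mul_mem (mul_mem hcoeff (natCast_mem integersInRat (n.choose (i + 1))))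
    (mul_mem (intCast_mem integersInRat q) (intCast_mem integersInRat r))
  convert hmem using 1
  rw [← mul_sub, hr']
  ring

open PowerSeries in
/-- If `L · tanh t = t (e^{yt} - 1)`, then `L` is expressed through Bernoulli polynomials. -/
lemma eq_of_mul_tanh_eq (y : ℚ) (L : ℚ⟦X⟧)
    (hL : L * ((exp ℚ - rescale (-1) (exp ℚ)) * (exp ℚ + rescale (-1) (exp ℚ))⁻¹) =
      X * (rescale y (exp ℚ) - 1)) :
    L = rescale 2 (mk fun n => ((n.factorial : ℚ)⁻¹) *
        ((Polynomial.bernoulli n).eval (y / 2) - bernoulli n)) +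
      X * (rescale y (exp ℚ) - 1) := by
  have hEE : exp ℚ * rescale (-1) (exp ℚ) = 1 := exp_mul_exp_neg_eq_one
  have hE2 : exp ℚ * exp ℚ = rescale 2 (exp ℚ) := by
    simpa [sq] using exp_pow_eq_rescale_exp (A := ℚ) 2
  have hunit : (exp ℚ + rescale (-1) (exp ℚ))⁻¹ * (exp ℚ + rescale (-1) (exp ℚ)) = 1 := by
    refine PowerSeries.inv_mul_cancel _ ?_
    rw [map_add, ← coeff_zero_eq_constantCoeff_apply, ← coeff_zero_eq_constantCoeff_apply,
      coeff_rescale, coeff_exp]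
    norm_num
  have hne : rescale 2 (exp ℚ) - 1 ≠ (0 : ℚ⟦X⟧) := fun h0 => by
    have := congrArg (coeff 1) h0
    simp [coeff_rescale, coeff_exp, coeff_one] at this
  have hB (x : ℚ) : rescale 2 (mk fun n => ((n.factorial : ℚ)⁻¹) *
      (Polynomial.bernoulli n).eval x) * (rescale 2 (exp ℚ) - 1) =
        C 2 * X * rescale (2 * x) (exp ℚ) := by
    have := congrArg (rescale (2 : ℚ)) (Polynomial.bernoulli_generating_function x)
    simpa [rescale_X, rescale_rescale, Polynomial.aeval_def, Polynomial.eval₂_eq_eval_map,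
      mul_comm x] using this
  have hsub : (mk fun n => ((n.factorial : ℚ)⁻¹) *
        ((Polynomial.bernoulli n).eval (y / 2) - bernoulli n) : ℚ⟦X⟧) =
      (mk fun n => ((n.factorial : ℚ)⁻¹) * (Polynomial.bernoulli n).eval (y / 2)) -
        mk fun n => ((n.factorial : ℚ)⁻¹) * (Polynomial.bernoulli n).eval 0 := by
    ext n
    simp [mul_sub]
  have h1 := hB (y / 2)
  have h0 := hB 0
  rw [mul_div_cancel₀ _ (two_ne_zero' ℚ)] at h1
  simp only [mul_zero, rescale_zero_apply, constantCoeff_exp, map_one, mul_one] at h0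
  rw [map_ofNat] at h0 h1
  apply mul_right_cancel₀ hne
  rw [hsub, map_sub, add_mul, sub_mul, h1, h0, ← hE2]
  set E := exp ℚ
  set F := rescale (-1 : ℚ) E
  set U := (E + F)⁻¹
  linear_combination E * (E + F) * hL - L * E * (E - F) * hunit +
    (L + X * (rescale y E - 1)) * hEE

/-- **Proposition 2.** The polynomials `λ̃_n(y)` defined by
`t·(e^{yt} − 1)/tanh(t) = Σ_{n≥0} λ̃_n(y) t^n/n!`
(with `tanh t = (e^t − e^{−t})/(e^t + e^{−t})`)
are in the Granville class: `k^n · λ̃_n(h/k) ∈ ℤ` for all `h ≥ 0`, `k ≥ 1`, `n ≥ 0`.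
The quotient is encoded by multiplying both sides by `tanh t`, mapped into `ℚ[y][[t]]`. -/
theorem lambdaTilde_granville (lam : ℕ → Polynomial ℚ)
    (hlam : (PowerSeries.mk fun n => ((n.factorial : ℚ)⁻¹) • lam n) *
        (PowerSeries.map (Polynomial.C : ℚ →+* Polynomial ℚ)
          ((PowerSeries.exp ℚ - PowerSeries.rescale (-1) (PowerSeries.exp ℚ)) *
            (PowerSeries.exp ℚ + PowerSeries.rescale (-1) (PowerSeries.exp ℚ))⁻¹))
      = PowerSeries.X *
          ((PowerSeries.mk fun m => ((m.factorial : ℚ)⁻¹) • (Polynomial.X : Polynomial ℚ) ^ m)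
            - 1)) :
    ∀ h k n : ℕ, 1 ≤ k → ∃ z : ℤ, (k : ℚ) ^ n * (lam n).eval ((h : ℚ) / (k : ℚ)) = (z : ℚ) := by
  intro h k n hk
  have hk0 : (k : ℚ) ≠ 0 := by exact_mod_cast (by lia : k ≠ 0)
  set y : ℚ := h / k with hy
  have hkey := congrArg (PowerSeries.map (Polynomial.evalRingHom y)) hlam
  have hid (f : PowerSeries ℚ) :
      PowerSeries.map (Polynomial.evalRingHom y) (PowerSeries.map Polynomial.C f) = f := by
    ext
    simp
  have hexp : PowerSeries.map (Polynomial.evalRingHom y)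
      (PowerSeries.mk fun m => ((m.factorial : ℚ)⁻¹) • (Polynomial.X : Polynomial ℚ) ^ m) =
        PowerSeries.rescale y (PowerSeries.exp ℚ) := by
    ext m
    simp [PowerSeries.coeff_exp, PowerSeries.coeff_rescale, mul_comm]
  rw [map_mul, hid, map_mul, PowerSeries.map_X, map_sub, map_one, hexp] at hkey
  have hcoeff := congrArg (PowerSeries.coeff n) (eq_of_mul_tanh_eq y _ hkey)
  have hf : (n.factorial : ℚ) ≠ 0 := by exact_mod_cast n.factorial_ne_zero
  have hAM := almkvist_meurman n h (2 * k) (by lia)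
  have hyk : ((h : ℚ) / (2 * k : ℕ)) = y / 2 := by
    rw [hy]
    push_cast
    field_simp
  rw [hyk] at hAM
  suffices hmem : (k : ℚ) ^ n * (lam n).eval y ∈ integersInRat by
    obtain ⟨z, hz⟩ := hmem
    exact ⟨z, hz.symm⟩
  have hlin : (k : ℚ) ^ n * (n.factorial * PowerSeries.coeff n
      (PowerSeries.X * (PowerSeries.rescale y (PowerSeries.exp ℚ) - 1))) ∈ integersInRat := by
    rcases n with _ | _ | m
    · simp
    · rw [PowerSeries.coeff_succ_X_mul, map_sub, PowerSeries.coeff_rescale, PowerSeries.coeff_exp,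
        PowerSeries.coeff_one]
      simp
    · rw [PowerSeries.coeff_succ_X_mul, map_sub, PowerSeries.coeff_rescale, PowerSeries.coeff_exp,
        PowerSeries.coeff_one, if_neg (Nat.succ_ne_zero m), Nat.factorial_succ (m + 1)]
      have hf' : ((m + 1).factorial : ℚ) ≠ 0 := by exact_mod_cast (m + 1).factorial_ne_zero
      have : (k : ℚ) ^ (m + 1 + 1) * (((m + 1 + 1) * (m + 1).factorial : ℕ) *
          (y ^ (m + 1) * algebraMap ℚ ℚ (1 / (m + 1).factorial) - 0)) =
            ((m + 1 + 1) * k * h ^ (m + 1) : ℕ) := by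
        rw [hy, div_pow]
        push_cast
        field_simp
        ring
      rw [this]
      exact natCast_mem _ _
  convert add_mem hAM hlin using 1
  rw [map_add] at hcoeff
  simp only [PowerSeries.coeff_map, PowerSeries.coeff_mk, PowerSeries.coeff_rescale,
    Polynomial.coe_evalRingHom, Polynomial.eval_smul, smul_eq_mul] at hcoeff
  rw [inv_mul_eq_iff_eq_mul₀ hf] at hcoeff
  rw [hcoeff]
  push_cast
  field_simp
  ring
end
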